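/- Let G be a finite connected simple graph of diameter 2 having at least one minimal vertex separator of cardinality 2. If the second largest distance eigenvalue of G satisfies λ2(G) < −1/2, then G is isomorphic to a connected induced subgraph of a relaxed block star, i.e., of a graph of the form K_1 ⊕ ((p_1 K_{r_1} ∪ ⋯ ∪ p_k K_{r_k}) ∪ q(K_1 ⊕ (K_1 ∪ K_2)) ∪ s P_3) for some positive integers k, p_1, …, p_k, r_1, …, r_k, q, s. -/

import Mathlib

open Polynomial SimpleGraph Sum

noncomputable section

/-- The distance matrix of a graph, with real entries. -/
def distMatrix {V : Type*} [Fintype V] (G : SimpleGraph V) : Matrix V V ℝ :=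
  Matrix.of fun u v => (G.dist u v : ℝ)

/-- The second largest distance eigenvalue: the eigenvalues of the distance matrix
(the roots of its characteristic polynomial, with multiplicity) are sorted in
increasing order, and we take the one at position `card V - 2`. -/
def lambda2 {V : Type*} [Fintype V] [DecidableEq V] (G : SimpleGraph V) : ℝ :=
  ((distMatrix G).charpoly.roots.sort (· ≤ ·)).getD (Fintype.card V - 2) 0

/-- The diameter of a finite graph. -/
def graphDiam {V : Type*} [Fintype V] (G : SimpleGraph V) : ℕ :=
  Finset.univ.sup fun p : V × V => G.dist p.1 p.2

/-- A graph is chordal if every cycle of length at least 4 has a chord. -/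
def IsChordal {V : Type*} (G : SimpleGraph V) : Prop :=
  ∀ (v : V) (c : G.Walk v v), c.IsCycle → 4 ≤ c.length →
    ∃ u w : V, u ∈ c.support ∧ w ∈ c.support ∧ G.Adj u w ∧ s(u, w) ∉ c.edges

/-- Ptolemaic graph: the Ptolemy inequality for the graph distance. -/
def IsPtolemaic {V : Type*} (G : SimpleGraph V) : Prop :=
  ∀ u v w x : V,
    G.dist u v * G.dist w x ≤ G.dist u w * G.dist v x + G.dist u x * G.dist v w

/-- `S` is a `uv`-separator: `u, v ∉ S` and every walk from `u` to `v` meets `S`. -/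
def IsUVSeparator {V : Type*} (G : SimpleGraph V) (S : Finset V) (u v : V) : Prop :=
  u ∉ S ∧ v ∉ S ∧ ∀ w : G.Walk u v, ∃ x ∈ w.support, x ∈ S

/-- `S` is a minimal vertex separator: a minimal `uv`-separator for some pair of
distinct non-adjacent vertices `u, v`. -/
def IsMinimalVertexSeparator {V : Type*} (G : SimpleGraph V) (S : Finset V) : Prop :=
  ∃ u v : V, u ≠ v ∧ ¬ G.Adj u v ∧ IsUVSeparator G S u v ∧
    ∀ T : Finset V, T ⊂ S → ¬ IsUVSeparator G T u v

/-- A connected component `K` of `G − S` is full if every vertex of `S` has a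
neighbour in `K`. -/
def IsFullComponent {V : Type*} (G : SimpleGraph V) (S : Finset V)
    (K : (G.induce ((S : Set V)ᶜ)).ConnectedComponent) : Prop :=
  ∀ a ∈ S, ∃ x : ((S : Set V)ᶜ : Set V),
    (G.induce ((S : Set V)ᶜ)).connectedComponentMk x = K ∧ G.Adj a ↑x

/-- The join `G ⊕ H` of two vertex-disjoint graphs. -/
def graphJoin {α β : Type*} (G : SimpleGraph α) (H : SimpleGraph β) :
    SimpleGraph (α ⊕ β) :=
  SimpleGraph.fromRel fun x y =>
    (∃ a b, x = Sum.inl a ∧ y = Sum.inl b ∧ G.Adj a b) ∨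
    (∃ a b, x = Sum.inr a ∧ y = Sum.inr b ∧ H.Adj a b) ∨
    (x.isLeft ∧ y.isRight)

/-- The disjoint union of two vertex-disjoint graphs. -/
def graphSum {α β : Type*} (G : SimpleGraph α) (H : SimpleGraph β) :
    SimpleGraph (α ⊕ β) :=
  SimpleGraph.fromRel fun x y =>
    (∃ a b, x = Sum.inl a ∧ y = Sum.inl b ∧ G.Adj a b) ∨
    (∃ a b, x = Sum.inr a ∧ y = Sum.inr b ∧ H.Adj a b)

/-- `p` disjoint copies of the complete graph `K_r`. -/
def cliqueCopies (p r : ℕ) : SimpleGraph (Fin p × Fin r) :=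
  SimpleGraph.fromRel fun x y => x.1 = y.1

/-- `q` disjoint copies of `K_1 ⊕ (K_1 ∪ K_2)` (the paw graph): in each copy,
vertex 0 is universal, vertex 1 is otherwise isolated, vertices 2,3 form a `K_2`. -/
def pawCopies (q : ℕ) : SimpleGraph (Fin q × Fin 4) :=
  SimpleGraph.fromRel fun x y => x.1 = y.1 ∧ (x.2 = 0 ∨ (x.2 = 2 ∧ y.2 = 3))

/-- `s` disjoint copies of the path `P_3`. -/
def path3Copies (s : ℕ) : SimpleGraph (Fin s × Fin 3) :=
  SimpleGraph.fromRel fun x y => x.1 = y.1 ∧ ((x.2 = 0 ∧ y.2 = 1) ∨ (x.2 = 1 ∧ y.2 = 2))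

/-- The disjoint union `p_1 K_{r_1} ∪ ⋯ ∪ p_k K_{r_k}`. -/
def multiCliques (k : ℕ) (p r : Fin k → ℕ) :
    SimpleGraph ((i : Fin k) × (Fin (p i) × Fin (r i))) :=
  SimpleGraph.fromRel fun x y =>
    (⟨x.1, x.2.1⟩ : (i : Fin k) × Fin (p i)) = ⟨y.1, y.2.1⟩

/-- The relaxed block star
`K_1 ⊕ ((p_1 K_{r_1} ∪ ⋯ ∪ p_k K_{r_k}) ∪ q (K_1 ⊕ (K_1 ∪ K_2)) ∪ s P_3)`. -/
def relaxedBlockStar (k : ℕ) (p r : Fin k → ℕ) (q s : ℕ) :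
    SimpleGraph (Unit ⊕ (((i : Fin k) × (Fin (p i) × Fin (r i))) ⊕
      ((Fin q × Fin 4) ⊕ (Fin s × Fin 3)))) :=
  graphJoin (⊤ : SimpleGraph Unit)
    (graphSum (multiCliques k p r) (graphSum (pawCopies q) (path3Copies s)))

/-- The graph `G(r,p,q) = K_1 ⊕ (p K_r ∪ q (K_1 ⊕ (K_1 ∪ K_2)))`. -/
def Grpq (r p q : ℕ) : SimpleGraph (Unit ⊕ ((Fin p × Fin r) ⊕ (Fin q × Fin 4))) :=
  graphJoin (⊤ : SimpleGraph Unit) (graphSum (cliqueCopies p r) (pawCopies q))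

/-- The full house graph `K_2 ⊕ (K_1 ∪ K_2)`: vertices 0,1 form the join-`K_2`,
vertex 2 is the `K_1`, vertices 3,4 form the `K_2`. -/
def fullHouse : SimpleGraph (Fin 5) :=
  SimpleGraph.fromRel fun x y => x = 0 ∨ x = 1 ∨ (x = 3 ∧ y = 4)

/-- The diamond graph: `K_4` minus an edge. -/
def diamondGraph : SimpleGraph (Fin 4) :=
  SimpleGraph.fromRel fun x y => x = 0 ∨ x = 1

/-- The path on four vertices. -/
def path4 : SimpleGraph (Fin 4) :=
  SimpleGraph.fromRel fun x y => (x : ℕ) + 1 = (y : ℕ)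

/-- The cycle on four vertices. -/
def cycle4 : SimpleGraph (Fin 4) :=
  SimpleGraph.fromRel fun x y => x + 1 = y

/-- The triple block graph `Pt_2(p,q)`: a full house (on `Fin 5`, with the
join-`K_2` being vertices `a = 0`, `b = 1`) together with `p - 1` further vertices
forming with `a` a clique `K_p` and `q - 1` further vertices forming with `b`
a clique `K_q`. -/
def Pt2Graph (p q : ℕ) : SimpleGraph (Fin 5 ⊕ (Fin (p - 1) ⊕ Fin (q - 1))) :=
  SimpleGraph.fromRel fun x y =>
    match x, y with
    | Sum.inl a, Sum.inl b => a = 0 ∨ a = 1 ∨ (a = 3 ∧ b = 4)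
    | Sum.inl a, Sum.inr (Sum.inl _) => a = 0
    | Sum.inl a, Sum.inr (Sum.inr _) => a = 1
    | Sum.inr (Sum.inl _), Sum.inr (Sum.inl _) => True
    | Sum.inr (Sum.inr _), Sum.inr (Sum.inr _) => True
    | _, _ => False

/-- The nine-vertex graph `Pt_1`: a full house (vertices 0,…,4, join-`K_2` being
`a = 0`, `b = 1`, `K_2` being 3,4), a vertex 5 adjacent only to `a`, a vertex 6
adjacent only to `b`, and vertices 7,8 adjacent to each other and to `b`. -/
def Pt1Graph : SimpleGraph (Fin 9) :=
  SimpleGraph.fromRel fun x y =>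
    (x = 0 ∧ (y = 1 ∨ y = 2 ∨ y = 3 ∨ y = 4 ∨ y = 5)) ∨
    (x = 1 ∧ (y = 2 ∨ y = 3 ∨ y = 4 ∨ y = 6 ∨ y = 7 ∨ y = 8)) ∨
    (x = 3 ∧ y = 4) ∨ (x = 7 ∧ y = 8)

/-- `G` contains an induced subgraph isomorphic to `H`. -/
def HasInducedSubgraph {V W : Type*} (G : SimpleGraph V) (H : SimpleGraph W) : Prop :=
  ∃ s : Set V, Nonempty ((G.induce s) ≃g H)

/-- `G` is isomorphic to a connected induced subgraph of `H`. -/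
def IsoToConnectedInducedSubgraph {V W : Type*} (G : SimpleGraph V)
    (H : SimpleGraph W) : Prop :=
  ∃ s : Set W, (H.induce s).Connected ∧ Nonempty (G ≃g (H.induce s))

/-- A vertex is simplicial if its neighbourhood is a clique. -/
def IsSimplicial {V : Type*} (G : SimpleGraph V) (v : V) : Prop :=
  G.IsClique (G.neighborSet v)

/-- The quintic polynomial `f(r,p,q,x)`. -/
def fpoly (r p q : ℕ) : Polynomial ℝ :=
  X ^ 5 - C (8 * (q : ℝ) + 2 * (r : ℝ) * (p : ℝ) - (r : ℝ) - 8) * X ^ 4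
    - C ((8 * (r : ℝ) + 36) * (q : ℝ) + 15 * (r : ℝ) * (p : ℝ) - 7 * (r : ℝ) - 20) * X ^ 3
    - C ((28 * (r : ℝ) + 52) * (q : ℝ) + 33 * (r : ℝ) * (p : ℝ) - 13 * (r : ℝ) - 18) * X ^ 2
    - C ((24 * (r : ℝ) + 30) * (q : ℝ) + 23 * (r : ℝ) * (p : ℝ) - 5 * (r : ℝ) - 5) * X
    - C ((6 * (r : ℝ) + 6) * (q : ℝ) + 5 * (r : ℝ) * (p : ℝ))

end

/-- The forbidden induced subgraphs of a graph all of whose components are complete or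
embed into the paw: `P₄` and `C₄` (in one field), the diamond, the claw, the butterfly
`K₁ ⊕ 2K₂` and `K₁ ⊕ (K₁ ∪ K₃)`. -/
structure IsCliquePawFree {W : Type*} (H : SimpleGraph W) : Prop where
  path : ∀ a b c d, H.Adj a b → H.Adj b c → H.Adj c d → ¬ H.Adj a c → ¬ H.Adj b d →
    a ≠ c → b ≠ d → False
  diamond : ∀ a b c d, H.Adj a b → H.Adj a c → H.Adj a d → H.Adj b c → H.Adj b d →
    ¬ H.Adj c d → c ≠ d → False
  claw : ∀ a b c d, H.Adj a b → H.Adj a c → H.Adj a d → ¬ H.Adj b c → ¬ H.Adj b d →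
    ¬ H.Adj c d → b ≠ c → b ≠ d → c ≠ d → False
  butterfly : ∀ w x x' y y', H.Adj w x → H.Adj w x' → H.Adj w y → H.Adj w y' →
    H.Adj x x' → H.Adj y y' → ¬ H.Adj x y → ¬ H.Adj x y' → ¬ H.Adj x' y → ¬ H.Adj x' y' → False
  kite : ∀ w x a b c, H.Adj w x → H.Adj w a → H.Adj w b → H.Adj w c →
    H.Adj a b → H.Adj a c → H.Adj b c → ¬ H.Adj x a → ¬ H.Adj x b → ¬ H.Adj x c → False

/-- Reachable vertices of a `P₄`- and `C₄`-free graph are at distance at most two. -/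
theorem dist_le_two_of_path_free {W : Type*} {H : SimpleGraph W}
    (hP : ∀ a b c d, H.Adj a b → H.Adj b c → H.Adj c d → ¬ H.Adj a c → ¬ H.Adj b d →
      a ≠ c → b ≠ d → False)
    {x y : W} (h : H.Reachable x y) : x = y ∨ H.Adj x y ∨ ∃ m, H.Adj x m ∧ H.Adj m y := by
  obtain ⟨p⟩ := h
  induction p with
  | nil => exact Or.inl rfl
  | @cons u v w h p ih =>
    by_cases huw : u = w
    · exact Or.inl huw
    by_cases hadj : H.Adj u w
    · exact Or.inr (Or.inl hadj)
    refine Or.inr (Or.inr ?_)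
    obtain rfl | hvw | ⟨m, hvm, hmw⟩ := ih
    · exact absurd h hadj
    · exact ⟨v, h, hvw⟩
    by_contra hcon
    push Not at hcon
    exact hP u v m w h hvm hmw (fun hum => hcon m hum hmw) (hcon v h)
      (by rintro rfl; exact hadj hmw) (by rintro rfl; exact hadj h)

/-- A finite connected `P₄`- and `C₄`-free graph has a universal vertex. -/
theorem exists_universal_of_path_free {V : Type*} [Finite V] {G : SimpleGraph V}
    (hG : G.Connected)
    (hP : ∀ a b c d, G.Adj a b → G.Adj b c → G.Adj c d → ¬ G.Adj a c → ¬ G.Adj b d →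
      a ≠ c → b ≠ d → False) : ∃ v, ∀ x, x ≠ v → G.Adj v x := by
  have := hG.nonempty
  obtain ⟨v, hv⟩ := Finite.exists_max fun v => (G.neighborSet v ∪ {v}).ncard
  refine ⟨v, fun x hx => ?_⟩
  by_contra hvx
  obtain h | h | ⟨y, hvy, hyx⟩ := dist_le_two_of_path_free hP (hG.preconnected v x)
  · exact hx h.symm
  · exact hvx h
  have hnot : ¬ G.neighborSet v ∪ {v} ⊆ G.neighborSet y ∪ {y} := by
    intro hsub
    have hss : G.neighborSet v ∪ {v} ⊂ G.neighborSet y ∪ {y} := by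
      refine ⟨hsub, fun h => ?_⟩
      rcases h (Or.inl hyx : x ∈ G.neighborSet y ∪ {y}) with h | h
      · exact hvx h
      · exact hx h
    exact absurd (hv y) (not_le.2 (Set.ncard_lt_ncard hss (Set.toFinite _)))
  obtain ⟨z, hz, hzy⟩ := Set.not_subset.1 hnot
  simp only [Set.mem_union, SimpleGraph.mem_neighborSet, Set.mem_singleton_iff, not_or] at hz hzy
  rcases hz with hz | rfl
  · exact hP z v y x hz.symm hvy hyx (fun h => hzy.1 h.symm) hvx hzy.2 hx.symm
  · exact hzy.1 hvy.symm

/-- Adjacency in the paw with universal vertex `0` and pendant vertex `1`. -/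
def pawAdj (i j : Fin 4) : Prop := i ≠ j ∧ (i = 0 ∨ j = 0 ∨ (i ≠ 1 ∧ j ≠ 1))

theorem exists_paw_labelling_of_pendant {W : Type*} {H : SimpleGraph W}
    (hH : IsCliquePawFree H) {w x y : W} (hwx : H.Adj w x) (hwy : H.Adj w y) (hne : x ≠ y)
    (hxy : ¬ H.Adj x y) (hx : ∀ z, H.Adj w z → ¬ H.Adj x z) :
    ∃ g : W → Fin 4, ∀ a b, (a = w ∨ H.Adj w a) → (b = w ∨ H.Adj w b) →
      (g a = g b → a = b) ∧ (H.Adj a b ↔ pawAdj (g a) (g b)) := by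
  classical
  have hy : ∀ z, H.Adj w z → z ≠ x → z ≠ y → H.Adj y z := by
    intro z hz hzx hzy
    by_contra h
    exact hH.claw w x y z hwx hwy hz hxy (hx z hz) h hne hzx.symm hzy.symm
  have huniq : ∀ z z', H.Adj w z → H.Adj w z' → z ≠ x → z ≠ y → z' ≠ x → z' ≠ y → z = z' := by
    intro z z' hz hz' h1 h2 h3 h4
    by_contra h
    have hzz : H.Adj z z' := by
      by_contra hn
      exact hH.diamond w y z z' hwy hz hz' (hy z hz h1 h2) (hy z' hz' h3 h4) hn h
    exact hH.kite w x y z z' hwx hwy hz hz' (hy z hz h1 h2) (hy z' hz' h3 h4) hzz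
      hxy (hx z hz) (hx z' hz')
  refine ⟨fun z => if z = w then 0 else if z = x then 1 else if z = y then 2 else 3, ?_⟩
  have hwx' := hwx.ne
  have hwy' := hwy.ne
  have hirr : ∀ z, ¬ H.Adj z z := fun z => H.irrefl
  have hsymm : ∀ z z', H.Adj z z' → H.Adj z' z := fun z z' h => h.symm
  intro a b ha hb
  simp only [pawAdj]
  grind

theorem exists_paw_labelling {W : Type*} {H : SimpleGraph W}
    (hH : IsCliquePawFree H) {x y : W} (hne : x ≠ y) (hxy : ¬ H.Adj x y) (hr : H.Reachable x y) :
    ∃ g : W → Fin 4, ∀ a b, H.Reachable x a → H.Reachable x b →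
      (g a = g b → a = b) ∧ (H.Adj a b ↔ pawAdj (g a) (g b)) := by
  obtain h | h | ⟨w, hxw, hwy⟩ := dist_le_two_of_path_free hH.path hr
  · exact absurd h hne
  · exact absurd h hxy
  have hdia := hH.diamond
  have huniv : ∀ z, H.Reachable x z → z = w ∨ H.Adj w z := by
    intro z hz
    obtain h | h | ⟨m, hwm, hmz⟩ :=
      dist_le_two_of_path_free hH.path (hxw.symm.reachable.trans hz)
    · exact Or.inl h.symm
    · exact Or.inr h
    by_contra hcon
    push Not at hcon
    obtain ⟨hzw, hwz⟩ := hcon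
    have key : ∀ s t, H.Adj w s → H.Adj w t → ¬ H.Adj s t → s ≠ t → H.Adj s z → False :=
      fun s t hs ht hst hne hsz =>
        hH.path z s w t hsz.symm hs.symm ht (fun h => hwz h.symm) hst hzw hne
    have hmx : H.Adj m x := by
      by_contra h
      refine key m x hwm hxw.symm h ?_ hmz
      rintro rfl
      exact key m y hxw.symm hwy hxy hne hmz
    have hmy : H.Adj m y := by
      by_contra h
      refine key m y hwm hwy h ?_ hmz
      rintro rfl
      exact key m x hwy hxw.symm (fun h => hxy h.symm) hne.symm hmz
    exact hdia w m x y hwm hxw.symm hwy hmx hmy hxy hne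
  by_cases hx : ∀ z, H.Adj w z → ¬ H.Adj x z
  · obtain ⟨g, hg⟩ := exists_paw_labelling_of_pendant hH hxw.symm hwy hne hxy hx
    exact ⟨g, fun a b ha hb => hg a b (huniv a ha) (huniv b hb)⟩
  · have hy : ∀ z, H.Adj w z → ¬ H.Adj y z := by
      push Not at hx
      obtain ⟨x', hwx', hxx'⟩ := hx
      intro y' hwy' hyy'
      have h1 : ¬ H.Adj x' y := fun h =>
        hdia w x' x y hwx' hxw.symm hwy hxx'.symm h hxy hne
      have h2 : ¬ H.Adj x y' := fun h =>
        hdia w y' x y hwy' hxw.symm hwy h.symm hyy'.symm hxy hne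
      have h3 : ¬ H.Adj x' y' := fun h =>
        hdia w x' x y' hwx' hxw.symm hwy' hxx'.symm h h2 (by rintro rfl; exact hxy hyy'.symm)
      exact hH.butterfly w x x' y y' hxw.symm hwx' hwy hwy' hxx' hyy' hxy h2 h1 h3
    obtain ⟨g, hg⟩ := exists_paw_labelling_of_pendant hH hwy hxw.symm hne.symm
      (fun h => hxy h.symm) hy
    exact ⟨g, fun a b ha hb => hg a b (huniv a ha) (huniv b hb)⟩

theorem distMatrix_isHermitian {V : Type*} [Fintype V] (G : SimpleGraph V) :
    (distMatrix G).IsHermitian := by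
  ext i j
  simp [distMatrix, SimpleGraph.dist_comm]

theorem lambda2_eq_eigenvalues₀ {V : Type*} [Fintype V] [DecidableEq V] (G : SimpleGraph V)
    (hV : 1 < Fintype.card V) :
    lambda2 G = (distMatrix_isHermitian G).eigenvalues₀ ⟨1, hV⟩ := by
  set hA := distMatrix_isHermitian G
  have hsort : (distMatrix G).charpoly.roots.sort (· ≤ ·)
      = (List.ofFn hA.eigenvalues₀).reverse := by
    rw [hA.roots_charpoly_eq_eigenvalues₀, Fin.univ_val_map, ← Multiset.coe_reverse,
      Multiset.coe_sort]
    apply List.mergeSort_of_pairwise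
    simp only [decide_eq_true_eq]
    rw [List.pairwise_reverse]
    exact hA.eigenvalues₀_antitone.sortedGE_ofFn.pairwise
  rw [lambda2, hsort, List.getD_eq_getElem _ _ (by simp; omega)]
  simp only [List.getElem_reverse, List.getElem_ofFn]
  congr 1
  simp only [List.length_ofFn, Fin.mk.injEq]
  omega

/-- If `λ₂(G) < -1/2`, the quadratic form of `D(G) + 1/2` is negative definite on a hyperplane. -/
theorem exists_hyperplane_of_lambda2_lt {V : Type*} [Fintype V] [DecidableEq V]
    (G : SimpleGraph V) (hV : 1 < Fintype.card V) (hlam : lambda2 G < -1/2) :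
    ∃ w : V → ℝ, ∀ z : V → ℝ, z ≠ 0 → ∑ i, w i * z i = 0 →
      ∑ i, ∑ j, z i * z j * G.dist i j + 1/2 * ∑ i, z i ^ 2 < 0 := by
  have hA := distMatrix_isHermitian G
  rw [lambda2_eq_eigenvalues₀ G hV] at hlam
  obtain ⟨i₀, hi₀⟩ : ∃ i₀, ∀ i ≠ i₀, hA.eigenvalues i < -1/2 := by
    refine ⟨Fintype.equivOfCardEq (Fintype.card_fin _) ⟨0, by omega⟩, fun i hi => ?_⟩
    refine lt_of_le_of_lt (hA.eigenvalues₀_antitone ?_) hlam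
    rw [Fin.le_def, Nat.one_le_iff_ne_zero]
    intro h
    apply hi
    rw [← Equiv.symm_apply_eq]
    exact Fin.ext h
  set b := hA.eigenvectorBasis with hb
  refine ⟨b i₀, fun z hz horth => ?_⟩
  set Z : EuclideanSpace ℝ V := WithLp.toLp 2 z with hZ
  set DZ : EuclideanSpace ℝ V := WithLp.toLp 2 ((distMatrix G).mulVec z) with hDZ
  have hc : ∀ i, inner ℝ (b i) DZ = hA.eigenvalues i * inner ℝ (b i) Z := by
    intro i
    have h1 := hA.mulVec_eigenvectorBasis i
    have h2 : inner ℝ (b i) DZ = dotProduct (b i : V → ℝ) ((distMatrix G).mulVec z) := by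
      simp [EuclideanSpace.inner_eq_star_dotProduct, hDZ, dotProduct_comm]
    have h3 : inner ℝ (b i) Z = dotProduct (b i : V → ℝ) z := by
      simp [EuclideanSpace.inner_eq_star_dotProduct, hZ, dotProduct_comm]
    have hT : (distMatrix G).transpose = distMatrix G := hA
    rw [h2, h3, Matrix.dotProduct_mulVec, ← Matrix.mulVec_transpose, hT, h1, smul_dotProduct,
      smul_eq_mul]
  have hzero : inner ℝ (b i₀) Z = 0 := by
    rw [← horth]
    simp [EuclideanSpace.inner_eq_star_dotProduct, hZ, dotProduct, mul_comm]
  have hQ : ∑ i, ∑ j, z i * z j * G.dist i j = inner ℝ Z DZ := by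
    simp only [hZ, hDZ, EuclideanSpace.inner_eq_star_dotProduct, dotProduct, Matrix.mulVec,
      distMatrix, Matrix.of_apply, star_trivial, Finset.sum_mul]
    exact Finset.sum_congr rfl fun i _ => Finset.sum_congr rfl fun j _ => by ring
  have hN : ∑ i, z i ^ 2 = inner ℝ Z Z := by
    simp only [hZ, EuclideanSpace.inner_eq_star_dotProduct, dotProduct, star_trivial, sq]
  have hZ0 : Z ≠ 0 := by
    simpa [hZ] using hz
  have hpos : 0 < inner ℝ Z Z := real_inner_self_pos.2 hZ0
  rw [hQ, hN, ← b.sum_inner_mul_inner Z DZ, ← b.sum_inner_mul_inner Z Z, Finset.mul_sum,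
    ← Finset.sum_add_distrib]
  rw [← b.sum_inner_mul_inner Z Z] at hpos
  have hterm : ∀ i, inner ℝ Z (b i) * inner ℝ (b i) Z = inner ℝ (b i) Z ^ 2 := fun i => by
    rw [real_inner_comm, sq]
  obtain ⟨i₁, -, hi₁⟩ := Finset.exists_lt_of_sum_lt (s := Finset.univ)
    (f := fun _ => (0 : ℝ)) (by simpa using hpos)
  have hne : i₁ ≠ i₀ := by
    rintro rfl
    simp [hzero] at hi₁
  refine Finset.sum_neg' (fun i _ => ?_) ⟨i₁, Finset.mem_univ _, ?_⟩
  · rw [hc]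
    by_cases h : i = i₀
    · simp [h, hzero]
    · have := hi₀ i h
      have := hterm i
      nlinarith [sq_nonneg (inner ℝ (b i) Z)]
  · rw [hc]
    have := hi₀ i₁ hne
    have := hterm i₁
    nlinarith

/-- Two independent vectors supported on `range f` spanning a plane on which the quadratic form of
`D(G) + 1/2` is nonnegative contradict negative definiteness on a hyperplane. -/
theorem false_of_nonneg_plane {V ι : Type*} [Fintype V] [Fintype ι] {G : SimpleGraph V}
    (hw : ∃ w : V → ℝ, ∀ z : V → ℝ, z ≠ 0 → ∑ i, w i * z i = 0 →
      ∑ i, ∑ j, z i * z j * G.dist i j + 1/2 * ∑ i, z i ^ 2 < 0)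
    (f : ι → V) (hf : Function.Injective f) (x y : ι → ℝ)
    (hxy : ∀ a b : ℝ, (∀ i, a * x i + b * y i = 0) → a = 0 ∧ b = 0)
    (hq : ∀ a b : ℝ, 0 ≤ ∑ i, ∑ j, (a * x i + b * y i) * (a * x j + b * y j) *
      G.dist (f i) (f j) + 1/2 * ∑ i, (a * x i + b * y i) ^ 2) : False := by
  obtain ⟨w, hw⟩ := hw
  have key : ∀ a b : ℝ, (a ≠ 0 ∨ b ≠ 0) → ∑ i, w (f i) * (a * x i + b * y i) = 0 → False := by
    intro a b hab hsum
    set z : ι → ℝ := fun i => a * x i + b * y i with hz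
    set Z : V → ℝ := Function.extend f z 0 with hZ
    have hZf : ∀ i, Z (f i) = z i := fun i => hf.extend_apply _ _ _
    have hZo : ∀ v, v ∉ Set.range f → Z v = 0 := fun v hv => by
      rw [hZ, Function.extend_apply' _ _ _ (by simpa using hv), Pi.zero_apply]
    have hpush : ∀ h : V → ℝ, (∀ v, v ∉ Set.range f → h v = 0) → ∑ i, h (f i) = ∑ v, h v :=
      fun h hh => Fintype.sum_of_injective f hf _ _ hh fun i => rfl
    have hneg := hw Z ?_ ?_
    · have hrow : ∀ i, ∑ j, z i * Z j * G.dist (f i) j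
          = ∑ j, z i * z j * G.dist (f i) (f j) := fun i => by
        rw [← hpush _ fun v hv => by simp [hZo v hv]]
        simp only [hZf]
      rw [← hpush _ fun v hv => by simp [hZo v hv], ← hpush _ fun v hv => by simp [hZo v hv]] at hneg
      simp only [hZf, hrow] at hneg
      exact absurd (hq a b) (not_le.2 hneg)
    · intro h0
      have := hxy a b fun i => by
        have := congrFun h0 (f i)
        rwa [hZf] at this
      tauto
    · rw [← hpush _ fun v hv => by simp [hZo v hv]]
      simpa only [hZf, hz] using hsum
  have hlin : ∀ a b : ℝ, ∑ i, w (f i) * (a * x i + b * y i)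
      = a * ∑ i, w (f i) * x i + b * ∑ i, w (f i) * y i := by
    intro a b
    rw [Finset.mul_sum, Finset.mul_sum, ← Finset.sum_add_distrib]
    exact Finset.sum_congr rfl fun i _ => by ring
  by_cases h : ∑ i, w (f i) * x i = 0
  · exact key 1 0 (by simp) (by rw [hlin, h]; ring)
  · exact key (∑ i, w (f i) * y i) (-∑ i, w (f i) * x i) (Or.inr (neg_ne_zero.2 h))
      (by rw [hlin]; ring)

/-- A configuration of vertices whose distances are prescribed by `D`, on which the quadratic form
of `D + 1/2` is nonnegative on a plane, contradicts negative definiteness on a hyperplane. -/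
theorem false_of_distances {V : Type*} [Fintype V] {G : SimpleGraph V} {m : ℕ}
    (hw : ∃ w : V → ℝ, ∀ z : V → ℝ, z ≠ 0 → ∑ i, w i * z i = 0 →
      ∑ i, ∑ j, z i * z j * G.dist i j + 1/2 * ∑ i, z i ^ 2 < 0)
    (f : Fin m → V) (D : Fin m → Fin m → ℕ) (hD : ∀ i j, G.dist (f i) (f j) = D i j)
    (hpos : ∀ i j, D i j = 0 → i = j) (x y : Fin m → ℝ)
    (hxy : ∀ a b : ℝ, (∀ i, a * x i + b * y i = 0) → a = 0 ∧ b = 0)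
    (hq : ∀ a b : ℝ, 0 ≤ ∑ i, ∑ j, (a * x i + b * y i) * (a * x j + b * y j) * D i j +
      1/2 * ∑ i, (a * x i + b * y i) ^ 2) : False := by
  refine false_of_nonneg_plane hw f (fun i j hij => hpos i j ?_) x y hxy ?_
  · rw [← hD, hij, SimpleGraph.dist_self]
  · simpa only [hD] using hq

theorem no_path_four_or_cycle_four {V : Type*} [Fintype V] {G : SimpleGraph V}
    (hw : ∃ w : V → ℝ, ∀ z : V → ℝ, z ≠ 0 → ∑ i, w i * z i = 0 →
      ∑ i, ∑ j, z i * z j * G.dist i j + 1/2 * ∑ i, z i ^ 2 < 0)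
    (h1 : ∀ {a b}, G.Adj a b → G.dist a b = 1 ∧ G.dist b a = 1)
    (h2 : ∀ {a b}, ¬ G.Adj a b → a ≠ b → G.dist a b = 2 ∧ G.dist b a = 2)
    (a b c d : V) (hab : G.Adj a b) (hbc : G.Adj b c)
    (hcd : G.Adj c d) (hac : ¬ G.Adj a c) (hbd : ¬ G.Adj b d) (nac : a ≠ c) (nbd : b ≠ d) :
    False := by
  have nad : a ≠ d := by rintro rfl; exact hac hcd.symm
  by_cases had : G.Adj a d
  · refine false_of_distances hw ![a, b, c, d]
      ![![0, 1, 2, 1], ![1, 0, 1, 2], ![2, 1, 0, 1], ![1, 2, 1, 0]] ?_ (by decide)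
      ![1, 1, 1, 1] ![1, -1, 1, -1] ?_ ?_
    · simp [Fin.forall_fin_succ, h1 hab, h1 hbc, h1 hcd, h2 hac nac, h2 hbd nbd, h1 had]
    · intro p q h
      have e0 := h 0
      have e1 := h 1
      simp at e0 e1
      constructor <;> linarith
    · intro p q
      simp [Fin.sum_univ_four]
      nlinarith [sq_nonneg p, sq_nonneg q]
  · refine false_of_distances hw ![a, b, c, d]
      ![![0, 1, 2, 2], ![1, 0, 1, 2], ![2, 1, 0, 1], ![2, 2, 1, 0]] ?_ (by decide)
      ![1, 0, 0, 1] ![1, -2, 2, -1] ?_ ?_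
    · simp [Fin.forall_fin_succ, h1 hab, h1 hbc, h1 hcd, h2 hac nac, h2 hbd nbd, h2 had nad]
    · intro p q h
      have e0 := h 0
      have e1 := h 1
      simp at e0 e1
      constructor <;> linarith
    · intro p q
      simp [Fin.sum_univ_four]
      nlinarith [sq_nonneg p, sq_nonneg q]

/-- `K₃ ⊕ 2K₁` is forbidden. -/
theorem no_cone_over_diamond {V : Type*} [Fintype V] {G : SimpleGraph V}
    (hw : ∃ w : V → ℝ, ∀ z : V → ℝ, z ≠ 0 → ∑ i, w i * z i = 0 →
      ∑ i, ∑ j, z i * z j * G.dist i j + 1/2 * ∑ i, z i ^ 2 < 0)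
    (h1 : ∀ {a b}, G.Adj a b → G.dist a b = 1 ∧ G.dist b a = 1)
    (h2 : ∀ {a b}, ¬ G.Adj a b → a ≠ b → G.dist a b = 2 ∧ G.dist b a = 2)
    (v a b c d : V) (hva : G.Adj v a) (hvb : G.Adj v b) (hvc : G.Adj v c)
    (hvd : G.Adj v d) (hab : G.Adj a b) (hac : G.Adj a c) (had : G.Adj a d) (hbc : G.Adj b c)
    (hbd : G.Adj b d) (hcd : ¬ G.Adj c d) (ncd : c ≠ d) : False := by
  refine false_of_distances hw ![v, a, b, c, d]
    ![![0, 1, 1, 1, 1], ![1, 0, 1, 1, 1], ![1, 1, 0, 1, 1], ![1, 1, 1, 0, 2], ![1, 1, 1, 2, 0]]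
    ?_ (by decide) ![1, 1, 1, 0, 0] ![0, 0, 0, 1, 1] ?_ ?_
  · simp [Fin.forall_fin_succ, h1 hva, h1 hvb, h1 hvc, h1 hvd, h1 hab, h1 hac, h1 had, h1 hbc,
      h1 hbd, h2 hcd ncd]
  · intro p q h
    have e0 := h 0
    have e1 := h 3
    simp at e0 e1
    exact ⟨e0, e1⟩
  · intro p q
    simp [Fin.sum_univ_five]
    nlinarith [sq_nonneg (5 * p + 4 * q), sq_nonneg q]

/-- `K₂ ⊕ 3K₁` is forbidden. -/
theorem no_cone_over_claw {V : Type*} [Fintype V] {G : SimpleGraph V}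
    (hw : ∃ w : V → ℝ, ∀ z : V → ℝ, z ≠ 0 → ∑ i, w i * z i = 0 →
      ∑ i, ∑ j, z i * z j * G.dist i j + 1/2 * ∑ i, z i ^ 2 < 0)
    (h1 : ∀ {a b}, G.Adj a b → G.dist a b = 1 ∧ G.dist b a = 1)
    (h2 : ∀ {a b}, ¬ G.Adj a b → a ≠ b → G.dist a b = 2 ∧ G.dist b a = 2)
    (v a b c d : V) (hva : G.Adj v a) (hvb : G.Adj v b) (hvc : G.Adj v c)
    (hvd : G.Adj v d) (hab : G.Adj a b) (hac : G.Adj a c) (had : G.Adj a d) (hbc : ¬ G.Adj b c)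
    (hbd : ¬ G.Adj b d) (hcd : ¬ G.Adj c d) (nbc : b ≠ c) (nbd : b ≠ d) (ncd : c ≠ d) :
    False := by
  refine false_of_distances hw ![v, a, b, c, d]
    ![![0, 1, 1, 1, 1], ![1, 0, 1, 1, 1], ![1, 1, 0, 2, 2], ![1, 1, 2, 0, 2], ![1, 1, 2, 2, 0]]
    ?_ (by decide) ![1, 1, 0, 0, 0] ![0, 0, 1, 1, 1] ?_ ?_
  · simp [Fin.forall_fin_succ, h1 hva, h1 hvb, h1 hvc, h1 hvd, h1 hab, h1 hac, h1 had, h2 hbc nbc,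
      h2 hbd nbd, h2 hcd ncd]
  · intro p q h
    have e0 := h 0
    have e1 := h 3
    simp at e0 e1
    exact ⟨e0, e1⟩
  · intro p q
    simp [Fin.sum_univ_five]
    nlinarith [sq_nonneg (p + 2 * q), sq_nonneg q]

/-- `K₂ ⊕ 2K₂` is forbidden. -/
theorem no_cone_over_butterfly {V : Type*} [Fintype V] {G : SimpleGraph V}
    (hw : ∃ w : V → ℝ, ∀ z : V → ℝ, z ≠ 0 → ∑ i, w i * z i = 0 →
      ∑ i, ∑ j, z i * z j * G.dist i j + 1/2 * ∑ i, z i ^ 2 < 0)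
    (h1 : ∀ {a b}, G.Adj a b → G.dist a b = 1 ∧ G.dist b a = 1)
    (h2 : ∀ {a b}, ¬ G.Adj a b → a ≠ b → G.dist a b = 2 ∧ G.dist b a = 2)
    (v w x x' y y' : V) (hvw : G.Adj v w) (hvx : G.Adj v x)
    (hvx' : G.Adj v x') (hvy : G.Adj v y) (hvy' : G.Adj v y') (hwx : G.Adj w x)
    (hwx' : G.Adj w x') (hwy : G.Adj w y) (hwy' : G.Adj w y') (hxx' : G.Adj x x')
    (hyy' : G.Adj y y') (hxy : ¬ G.Adj x y) (hxy' : ¬ G.Adj x y') (hx'y : ¬ G.Adj x' y)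
    (hx'y' : ¬ G.Adj x' y') : False := by
  have n1 : x ≠ y := by rintro rfl; exact hxy' hyy'
  have n2 : x ≠ y' := by rintro rfl; exact hxy hyy'.symm
  have n3 : x' ≠ y := by rintro rfl; exact hxy hxx'
  have n4 : x' ≠ y' := by rintro rfl; exact hxy' hxx'
  refine false_of_distances hw ![v, w, x, x', y, y']
    ![![0, 1, 1, 1, 1, 1], ![1, 0, 1, 1, 1, 1], ![1, 1, 0, 1, 2, 2], ![1, 1, 1, 0, 2, 2],
      ![1, 1, 2, 2, 0, 1], ![1, 1, 2, 2, 1, 0]]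
    ?_ (by decide) ![1, 1, 0, 0, 0, 0] ![0, 0, 1, 1, 1, 1] ?_ ?_
  · simp [Fin.forall_fin_succ, h1 hvw, h1 hvx, h1 hvx', h1 hvy, h1 hvy', h1 hwx, h1 hwx', h1 hwy,
      h1 hwy', h1 hxx', h1 hyy', h2 hxy n1, h2 hxy' n2, h2 hx'y n3, h2 hx'y' n4]
  · intro p q h
    have e0 := h 0
    have e1 := h 3
    simp at e0 e1
    exact ⟨e0, e1⟩
  · intro p q
    simp [Fin.sum_univ_six]
    nlinarith [sq_nonneg (3 * p + 8 * q), sq_nonneg q]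

/-- `K₂ ⊕ (K₁ ∪ K₃)` is forbidden. -/
theorem no_cone_over_kite {V : Type*} [Fintype V] {G : SimpleGraph V}
    (hw : ∃ w : V → ℝ, ∀ z : V → ℝ, z ≠ 0 → ∑ i, w i * z i = 0 →
      ∑ i, ∑ j, z i * z j * G.dist i j + 1/2 * ∑ i, z i ^ 2 < 0)
    (h1 : ∀ {a b}, G.Adj a b → G.dist a b = 1 ∧ G.dist b a = 1)
    (h2 : ∀ {a b}, ¬ G.Adj a b → a ≠ b → G.dist a b = 2 ∧ G.dist b a = 2)
    (v w x a b c : V) (hvw : G.Adj v w) (hvx : G.Adj v x)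
    (hva : G.Adj v a) (hvb : G.Adj v b) (hvc : G.Adj v c) (hwx : G.Adj w x) (hwa : G.Adj w a)
    (hwb : G.Adj w b) (hwc : G.Adj w c) (hab : G.Adj a b) (hac : G.Adj a c) (hbc : G.Adj b c)
    (hxa : ¬ G.Adj x a) (hxb : ¬ G.Adj x b) (hxc : ¬ G.Adj x c) : False := by
  have n1 : x ≠ a := by rintro rfl; exact hxb hab
  have n2 : x ≠ b := by rintro rfl; exact hxa hab.symm
  have n3 : x ≠ c := by rintro rfl; exact hxa hac.symm
  refine false_of_distances hw ![v, w, x, a, b, c]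
    ![![0, 1, 1, 1, 1, 1], ![1, 0, 1, 1, 1, 1], ![1, 1, 0, 2, 2, 2], ![1, 1, 2, 0, 1, 1],
      ![1, 1, 2, 1, 0, 1], ![1, 1, 2, 1, 1, 0]]
    ?_ (by decide) ![1, 1, 0, 0, 0, 0] ![-10, -10, 6, 3, 3, 3] ?_ ?_
  · simp [Fin.forall_fin_succ, h1 hvw, h1 hvx, h1 hva, h1 hvb, h1 hvc, h1 hwx, h1 hwa, h1 hwb,
      h1 hwc, h1 hab, h1 hac, h1 hbc, h2 hxa n1, h2 hxb n2, h2 hxc n3]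
  · intro p q h
    have e0 := h 0
    have e1 := h 3
    simp at e0 e1
    subst e1
    exact ⟨by linarith, rfl⟩
  · intro p q
    simp [Fin.sum_univ_six]
    nlinarith [sq_nonneg p, sq_nonneg q]

theorem isCliquePawFree_deleteIncidenceSet {V : Type*} [Fintype V] {G : SimpleGraph V}
    (hw : ∃ w : V → ℝ, ∀ z : V → ℝ, z ≠ 0 → ∑ i, w i * z i = 0 →
      ∑ i, ∑ j, z i * z j * G.dist i j + 1/2 * ∑ i, z i ^ 2 < 0)
    (h1 : ∀ {a b}, G.Adj a b → G.dist a b = 1 ∧ G.dist b a = 1)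
    (h2 : ∀ {a b}, ¬ G.Adj a b → a ≠ b → G.dist a b = 2 ∧ G.dist b a = 2)
    {v : V} (hv : ∀ x, x ≠ v → G.Adj v x) : IsCliquePawFree (G.deleteIncidenceSet v) := by
  have hadj : ∀ {a b}, (G.deleteIncidenceSet v).Adj a b → G.Adj a b := fun h =>
    (SimpleGraph.deleteIncidenceSet_adj.1 h).1
  have hl : ∀ {a b}, (G.deleteIncidenceSet v).Adj a b → a ≠ v := fun h =>
    (SimpleGraph.deleteIncidenceSet_adj.1 h).2.1
  have hr : ∀ {a b}, (G.deleteIncidenceSet v).Adj a b → b ≠ v := fun h =>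
    (SimpleGraph.deleteIncidenceSet_adj.1 h).2.2
  have hnot : ∀ {a b}, ¬ (G.deleteIncidenceSet v).Adj a b → a ≠ v → b ≠ v → ¬ G.Adj a b :=
    fun h ha hb hab => h (SimpleGraph.deleteIncidenceSet_adj.2 ⟨hab, ha, hb⟩)
  constructor
  · intro a b c d hab hbc hcd hac hbd nac nbd
    exact no_path_four_or_cycle_four hw h1 h2 a b c d (hadj hab) (hadj hbc) (hadj hcd)
      (hnot hac (hl hab) (hr hbc)) (hnot hbd (hr hab) (hr hcd)) nac nbd
  · intro a b c d hab hac had hbc hbd hcd ncd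
    exact no_cone_over_diamond hw h1 h2 v a b c d (hv a (hl hab)) (hv b (hr hab)) (hv c (hr hac))
      (hv d (hr had)) (hadj hab) (hadj hac) (hadj had) (hadj hbc) (hadj hbd)
      (hnot hcd (hr hac) (hr had)) ncd
  · intro a b c d hab hac had hbc hbd hcd nbc nbd ncd
    exact no_cone_over_claw hw h1 h2 v a b c d (hv a (hl hab)) (hv b (hr hab)) (hv c (hr hac))
      (hv d (hr had)) (hadj hab) (hadj hac) (hadj had) (hnot hbc (hr hab) (hr hac))
      (hnot hbd (hr hab) (hr had)) (hnot hcd (hr hac) (hr had)) nbc nbd ncd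
  · intro w x x' y y' hwx hwx' hwy hwy' hxx' hyy' hxy hxy' hx'y hx'y'
    exact no_cone_over_butterfly hw h1 h2 v w x x' y y' (hv w (hl hwx)) (hv x (hr hwx))
      (hv x' (hr hwx')) (hv y (hr hwy)) (hv y' (hr hwy')) (hadj hwx) (hadj hwx') (hadj hwy)
      (hadj hwy') (hadj hxx') (hadj hyy') (hnot hxy (hr hwx) (hr hwy))
      (hnot hxy' (hr hwx) (hr hwy')) (hnot hx'y (hr hwx') (hr hwy))
      (hnot hx'y' (hr hwx') (hr hwy'))
  · intro w x a b c hwx hwa hwb hwc hab hac hbc hxa hxb hxc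
    exact no_cone_over_kite hw h1 h2 v w x a b c (hv w (hl hwx)) (hv x (hr hwx)) (hv a (hr hwa))
      (hv b (hr hwb)) (hv c (hr hwc)) (hadj hwx) (hadj hwa) (hadj hwb) (hadj hwc) (hadj hab)
      (hadj hac) (hadj hbc) (hnot hxa (hr hwx) (hr hwa)) (hnot hxb (hr hwx) (hr hwb))
      (hnot hxc (hr hwx) (hr hwc))

theorem graphJoin_adj {α β : Type*} (G : SimpleGraph α) (H : SimpleGraph β) (x y : α ⊕ β) :
    (graphJoin G H).Adj x y ↔ match x, y with
      | Sum.inl a, Sum.inl b => G.Adj a b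
      | Sum.inr a, Sum.inr b => H.Adj a b
      | _, _ => True := by
  rcases x with x | x <;> rcases y with y | y <;>
    simp [graphJoin, SimpleGraph.fromRel_adj, SimpleGraph.adj_comm]
  all_goals exact fun h => h.ne

theorem graphSum_adj {α β : Type*} (G : SimpleGraph α) (H : SimpleGraph β) (x y : α ⊕ β) :
    (graphSum G H).Adj x y ↔ match x, y with
      | Sum.inl a, Sum.inl b => G.Adj a b
      | Sum.inr a, Sum.inr b => H.Adj a b
      | _, _ => False := by
  rcases x with x | x <;> rcases y with y | y <;>
    simp [graphSum, SimpleGraph.fromRel_adj, SimpleGraph.adj_comm]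
  all_goals exact fun h => h.ne

theorem pawCopies_adj (q : ℕ) (x y : Fin q × Fin 4) :
    (pawCopies q).Adj x y ↔ x.1 = y.1 ∧ pawAdj x.2 y.2 := by
  obtain ⟨c, i⟩ := x
  obtain ⟨d, j⟩ := y
  by_cases hcd : c = d
  · subst hcd
    simp only [pawCopies, SimpleGraph.fromRel_adj, pawAdj, ne_eq, Prod.mk.injEq, true_and]
    revert i j
    decide
  · simp [pawCopies, SimpleGraph.fromRel_adj, hcd, Ne.symm hcd]

theorem multiCliques_adj {k : ℕ} {p r : Fin k → ℕ} (i : Fin k) (x y : Fin (p i) × Fin (r i)) :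
    (multiCliques k p r).Adj ⟨i, x⟩ ⟨i, y⟩ ↔ x ≠ y ∧ x.1 = y.1 := by
  simp [multiCliques, SimpleGraph.fromRel_adj, eq_comm]

theorem isoToConnectedInducedSubgraph_of_embedding {V W : Type*} {G : SimpleGraph V}
    {H : SimpleGraph W} (hG : G.Connected) (φ : G ↪g H) : IsoToConnectedInducedSubgraph G H := by
  let e : G ≃g H.induce (Set.range φ) :=
    { Equiv.ofInjective φ φ.injective with
      map_rel_iff' := by
        intro a b
        exact φ.map_rel_iff }
  exact ⟨Set.range φ, e.connected_iff.1 hG, ⟨e⟩⟩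

theorem exists_embedding_relaxedBlockStar {V : Type*} [Fintype V] {G : SimpleGraph V} {v : V}
    (hv : ∀ x, x ≠ v → G.Adj v x) (hH : IsCliquePawFree (G.deleteIncidenceSet v)) :
    Nonempty (G ↪g relaxedBlockStar 1 (fun _ => Fintype.card V) (fun _ => Fintype.card V)
      (Fintype.card V) (Fintype.card V)) := by
  classical
  set H := G.deleteIncidenceSet v with hHdef
  let e := Fintype.equivFin V
  let c : V → Fin (Fintype.card V) := fun x => e (H.connectedComponentMk x).out
  have hc : ∀ x y, c x = c y ↔ H.Reachable x y := by
    intro x y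
    rw [← SimpleGraph.ConnectedComponent.eq]
    constructor
    · intro h
      rw [← (H.connectedComponentMk x).out_eq, ← (H.connectedComponentMk y).out_eq, e.injective h]
    · intro h
      simp only [c, h]
  let P : Fin (Fintype.card V) → Prop := fun i => ∀ a b, c a = i → c b = i → a ≠ b → H.Adj a b
  have hg : ∀ i, ∃ g : V → Fin 4, ¬ P i → ∀ a b, c a = i → c b = i →
      (g a = g b → a = b) ∧ (H.Adj a b ↔ pawAdj (g a) (g b)) := by
    intro i
    by_cases hi : P i
    · exact ⟨fun _ => 0, fun h => absurd hi h⟩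
    · simp only [P] at hi
      push Not at hi
      obtain ⟨x, y, hx, hy, hne, hxy⟩ := hi
      obtain ⟨g, hg⟩ := exists_paw_labelling hH hne hxy ((hc x y).1 (hx.trans hy.symm))
      exact ⟨g, fun _ a b ha hb => hg a b ((hc x a).1 (hx.trans ha.symm))
        ((hc x b).1 (hx.trans hb.symm))⟩
  choose g hg using hg
  have hcadj : ∀ x y, H.Adj x y → c x = c y := fun x y h => (hc x y).2 h.reachable
  have hGH : ∀ x y, x ≠ v → y ≠ v → (G.Adj x y ↔ H.Adj x y) := fun x y hx hy => by
    rw [hHdef, SimpleGraph.deleteIncidenceSet_adj]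
    tauto
  let φ : V → Unit ⊕ (((i : Fin 1) × (Fin (Fintype.card V) × Fin (Fintype.card V))) ⊕
      ((Fin (Fintype.card V) × Fin 4) ⊕ (Fin (Fintype.card V) × Fin 3))) := fun x =>
    if x = v then Sum.inl () else
    if P (c x) then Sum.inr (Sum.inl ⟨0, (c x, e x)⟩) else
      Sum.inr (Sum.inr (Sum.inl (c x, g (c x) x)))
  have hinj : Function.Injective φ := by
    intro x y hxy
    simp only [φ] at hxy
    split_ifs at hxy with h1 h2 h3 h4 h5 h6 h7 h8
    · rw [h1, h2]
    all_goals simp at hxy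
    · exact hxy.2
    · obtain ⟨h, h'⟩ := hxy
      rw [← h] at h'
      exact ((hg _ ‹_› x y rfl h.symm).1 h')
  refine ⟨⟨⟨φ, hinj⟩, ?_⟩⟩
  intro x y
  change (relaxedBlockStar _ _ _ _ _).Adj (φ x) (φ y) ↔ G.Adj x y
  by_cases hx : x = v
  · by_cases hy : y = v
    · simp [hx, hy]
    · simp only [φ, hx, hy, relaxedBlockStar, graphJoin_adj, if_true, if_false]
      split_ifs <;> simpa using hv y hy
  by_cases hy : y = v
  · simp only [φ, hx, hy, relaxedBlockStar, graphJoin_adj, if_true, if_false]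
    split_ifs <;> simpa using (hv x hx).symm
  rw [hGH x y hx hy]
  by_cases hPx : P (c x) <;> by_cases hPy : P (c y) <;>
    simp only [φ, hx, hy, hPx, hPy, relaxedBlockStar, graphJoin_adj, graphSum_adj, if_true,
      if_false, multiCliques_adj, pawCopies_adj]
  · constructor
    · rintro ⟨hne, h⟩
      exact hPx x y rfl h.symm (by rintro rfl; exact hne rfl)
    · intro h
      exact ⟨fun h' => h.ne (e.injective (congrArg Prod.snd h')), hcadj x y h⟩
  · exact ⟨False.elim, fun h => hPy (hcadj x y h ▸ hPx)⟩
  · exact ⟨False.elim, fun h => hPx (hcadj x y h ▸ hPy)⟩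
  · constructor
    · rintro ⟨h, h'⟩
      rw [← h] at h'
      exact (hg _ hPx x y rfl h.symm).2.2 h'
    · intro h
      have hcxy := hcadj x y h
      refine ⟨hcxy, ?_⟩
      rw [← hcxy]
      exact (hg _ hPx x y rfl hcxy.symm).2.1 h

/-- A connected graph of diameter 2 with a minimal vertex separator of cardinality 2
and second largest distance eigenvalue less than `-1/2` is isomorphic to a connected
induced subgraph of a relaxed block star. -/
theorem stmt_3 {V : Type*} [Fintype V] [DecidableEq V] (G : SimpleGraph V)
    (hconn : G.Connected) (hdiam : graphDiam G = 2)
    (hmvs : ∃ S : Finset V, S.card = 2 ∧ IsMinimalVertexSeparator G S)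
    (hlam : lambda2 G < -1/2) :
    ∃ (k : ℕ) (p r : Fin k → ℕ) (q s : ℕ), 0 < k ∧ (∀ i, 0 < p i) ∧ (∀ i, 0 < r i) ∧
      0 < q ∧ 0 < s ∧ IsoToConnectedInducedSubgraph G (relaxedBlockStar k p r q s) := by
  have hle : ∀ a b, G.dist a b ≤ 2 := fun a b => by
    rw [← hdiam]
    exact Finset.le_sup (f := fun p : V × V => G.dist p.1 p.2) (Finset.mem_univ (a, b))
  have h1 : ∀ {a b}, G.Adj a b → G.dist a b = 1 ∧ G.dist b a = 1 := fun h =>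
    ⟨SimpleGraph.dist_eq_one_iff_adj.2 h, SimpleGraph.dist_eq_one_iff_adj.2 h.symm⟩
  have h2 : ∀ {a b}, ¬ G.Adj a b → a ≠ b → G.dist a b = 2 ∧ G.dist b a = 2 := by
    intro a b h hne
    have hpos := hconn.pos_dist_of_ne hne
    have hone : G.dist a b ≠ 1 := fun h' => h (SimpleGraph.dist_eq_one_iff_adj.1 h')
    have := hle a b
    rw [SimpleGraph.dist_comm (u := b)]
    omega
  obtain ⟨_, _, u, u', hne, _⟩ := hmvs
  have hw := exists_hyperplane_of_lambda2_lt G (Fintype.one_lt_card_iff.2 ⟨u, u', hne⟩) hlam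
  obtain ⟨v, hv⟩ := exists_universal_of_path_free hconn (no_path_four_or_cycle_four hw h1 h2)
  obtain ⟨φ⟩ := exists_embedding_relaxedBlockStar hv
    (isCliquePawFree_deleteIncidenceSet hw h1 h2 hv)
  have hcard : 0 < Fintype.card V := Fintype.card_pos_iff.2 ⟨v⟩
  exact ⟨1, _, _, _, _, one_pos, fun _ => hcard, fun _ => hcard, hcard, hcard,
    isoToConnectedInducedSubgraph_of_embedding hconn φ⟩
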